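/- Let X be a cubespace with the glueing property and let (t_ν)_{ν ∈ {0,1}^k} be a tri-cube in X: each t_ν ∈ C^k(X), and whenever ν, ν', ω ∈ {0,1}^k satisfy, for every i, ν_i = ν'_i or ω_i = 1, we have t_ν(ω) = t_{ν'}(ω). Then the outer cube ω ↦ t_ω(0,...,0) lies in C^k(X). -/

import Mathlib

/-- A morphism of discrete cubes `{0,1}^k → {0,1}^ℓ`: each coordinate function is
identically `0`, identically `1`, equal to `ω_j`, or equal to `1 - ω_j`. -/
def IsCubeMorphism {k l : ℕ} (ρ : (Fin k → Bool) → (Fin l → Bool)) : Prop :=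
  ∀ i : Fin l, (∀ ω, ρ ω i = false) ∨ (∀ ω, ρ ω i = true) ∨
    (∃ j, ∀ ω, ρ ω i = ω j) ∨ (∃ j, ∀ ω, ρ ω i = !(ω j))

/-- A cubespace: a set `X` with cube sets `C^k(X) ⊆ X^{{0,1}^k}`, with `C^0(X) = X`,
closed under precomposition with morphisms of discrete cubes. -/
structure Cubespace (X : Type*) where
  C : ∀ k : ℕ, Set ((Fin k → Bool) → X)
  C_zero : C 0 = Set.univ
  C_morph : ∀ {k l : ℕ} (ρ : (Fin k → Bool) → (Fin l → Bool)),
    IsCubeMorphism ρ → ∀ c ∈ C l, (c ∘ ρ) ∈ C k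

/-- The top vertex `(1,…,1)` of the discrete cube `{0,1}^k`. -/
def topVert (k : ℕ) : Fin k → Bool := fun _ => true

/-- An `(n+1)`-corner: a configuration whose restriction to every lower
codimension-1 face is an `n`-cube (the value at the top vertex is irrelevant). -/
def IsCubeCorner {X : Type*} (CS : Cubespace X) (n : ℕ) (lam : (Fin (n + 1) → Bool) → X) : Prop :=
  ∀ i : Fin (n + 1), (fun ω : Fin n → Bool => lam (i.insertNth false ω)) ∈ CS.C n

/-- `(n+1)`-completion: every `(n+1)`-corner can be completed to an `(n+1)`-cube. -/
def HasCompletion {X : Type*} (CS : Cubespace X) (n : ℕ) : Prop :=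
  ∀ lam : (Fin (n + 1) → Bool) → X, IsCubeCorner CS n lam →
    ∃ x : X, (fun ω => if ω = topVert (n + 1) then x else lam ω) ∈ CS.C (n + 1)

/-- `k`-uniqueness: two `k`-cubes agreeing at all vertices except the top vertex are equal. -/
def HasUniqueness {X : Type*} (CS : Cubespace X) (k : ℕ) : Prop :=
  ∀ c ∈ CS.C k, ∀ c' ∈ CS.C k, (∀ ω, ω ≠ topVert k → c ω = c' ω) → c = c'

/-- The glueing property: two `(n+1)`-cubes agreeing along a common codimension-1 face
can be glued to form another `(n+1)`-cube. -/
def HasGlueing {X : Type*} (CS : Cubespace X) : Prop :=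
  ∀ (n : ℕ) (c c' : (Fin (n + 1) → Bool) → X), c ∈ CS.C (n + 1) → c' ∈ CS.C (n + 1) →
    (∀ ω : Fin n → Bool, c (Fin.snoc ω true) = c' (Fin.snoc ω false)) →
    (fun ω : Fin (n + 1) → Bool => if ω (Fin.last n) = true then c' ω else c ω) ∈ CS.C (n + 1)

/-- A cubespace morphism: maps `k`-cubes to `k`-cubes for every `k`. -/
def IsMorphism {X Y : Type*} (CX : Cubespace X) (CY : Cubespace Y) (f : X → Y) : Prop :=
  ∀ k : ℕ, ∀ c ∈ CX.C k, (fun ω => f (c ω)) ∈ CY.C k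

/-- A fibration: a cubespace morphism such that every corner of `X` lying over
(all but the top vertex of) a cube of `Y` can be completed to a cube of `X`
mapping onto that cube.  (The `k = 0` case of corner completion is surjectivity.) -/
def IsFibration {X Y : Type*} (CX : Cubespace X) (CY : Cubespace Y) (f : X → Y) : Prop :=
  IsMorphism CX CY f ∧ Function.Surjective f ∧
  ∀ (n : ℕ) (lam : (Fin (n + 1) → Bool) → X) (c : (Fin (n + 1) → Bool) → Y),
    IsCubeCorner CX n lam → c ∈ CY.C (n + 1) →
    (∀ ω, ω ≠ topVert (n + 1) → f (lam ω) = c ω) →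
    ∃ x : X, f x = c (topVert (n + 1)) ∧
      (fun ω => if ω = topVert (n + 1) then x else lam ω) ∈ CX.C (n + 1)

namespace Cubespace

variable {X : Type*} (CS : Cubespace X)

theorem comp_perm_mem {k : ℕ} (σ : Equiv.Perm (Fin k)) {c : (Fin k → Bool) → X}
    (hc : c ∈ CS.C k) : (fun ω => c (ω ∘ σ)) ∈ CS.C k :=
  CS.C_morph (fun ω => ω ∘ σ) (fun i => .inr (.inr (.inl ⟨σ i, fun _ => rfl⟩))) c hc

theorem comp_flip_mem {k : ℕ} (a : Fin k) {c : (Fin k → Bool) → X} (hc : c ∈ CS.C k) :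
    (fun ω => c (Function.update ω a (!ω a))) ∈ CS.C k := by
  refine CS.C_morph (fun ω => Function.update ω a (!ω a)) (fun i => ?_) c hc
  by_cases h : i = a
  · subst h
    exact .inr (.inr (.inr ⟨i, fun ω => by simp⟩))
  · exact .inr (.inr (.inl ⟨i, fun ω => by simp [h]⟩))

/-- Glueing along an arbitrary coordinate direction. -/
theorem glue_at (hglue : HasGlueing CS) {k : ℕ} (a : Fin k) {c c' : (Fin k → Bool) → X}
    (hc : c ∈ CS.C k) (hc' : c' ∈ CS.C k)
    (h : ∀ ω, c (Function.update ω a true) = c' (Function.update ω a false)) :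
    (fun ω => if ω a = true then c' ω else c ω) ∈ CS.C k := by
  cases k with
  | zero => exact a.elim0
  | succ n =>
    let σ : Equiv.Perm (Fin (n + 1)) := Equiv.swap a (Fin.last n)
    have hsnoc : ∀ (ω : Fin n → Bool) (b d : Bool),
        (Fin.snoc ω b : Fin (n + 1) → Bool) ∘ σ =
          Function.update ((Fin.snoc ω d : Fin (n + 1) → Bool) ∘ σ) a b := by
      intro ω b d
      funext i
      by_cases hi : i = a
      · subst hi
        simp [σ]
      · have hne : σ i ≠ Fin.last n := fun e =>
          hi (σ.injective (e.trans (Equiv.swap_apply_left a (Fin.last n)).symm))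
        obtain ⟨j, hj⟩ := Fin.exists_castSucc_eq.2 hne
        simp [hi, ← hj]
    have key := CS.comp_perm_mem σ (hglue n _ _ (CS.comp_perm_mem σ hc)
      (CS.comp_perm_mem σ hc') fun ω => by
        rw [hsnoc ω true true, hsnoc ω false true]
        exact h _)
    have hσ : ∀ ω : Fin (n + 1) → Bool, (ω ∘ σ) ∘ σ = ω := fun ω => by
      funext i
      simp [σ]
    simpa only [hσ, Function.comp_apply, σ, Equiv.swap_apply_right] using key

end Cubespace

/-- The partial outer cube of a tri-cube `t`: in the directions of `S` it runs along the outer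
vertices, in the remaining directions it runs inside the cube indexed by `ν`. -/
def partialOuter {X : Type*} {k : ℕ} (t : (Fin k → Bool) → (Fin k → Bool) → X)
    (S : Finset (Fin k)) (ν ω : Fin k → Bool) : X :=
  t (fun i => if i ∈ S then ω i else ν i) (fun i => if i ∈ S then false else ω i)

theorem partialOuter_mem {X : Type*} (CS : Cubespace X) (hglue : HasGlueing CS) {k : ℕ}
    (t : (Fin k → Bool) → (Fin k → Bool) → X) (ht : ∀ ν, t ν ∈ CS.C k)
    (hcompat : ∀ ν ν' ω : Fin k → Bool,
      (∀ i, ν i = ν' i ∨ ω i = true) → t ν ω = t ν' ω)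
    (S : Finset (Fin k)) (ν : Fin k → Bool) : partialOuter t S ν ∈ CS.C k := by
  induction S using Finset.induction_on generalizing ν with
  | empty =>
    convert ht ν using 1
    funext ω
    simp [partialOuter]
  | insert a S ha ih =>
    convert CS.glue_at hglue a (ih (Function.update ν a false))
      (CS.comp_flip_mem a (ih (Function.update ν a true))) ?_ using 1
    · funext ω
      cases hω : ω a
      all_goals
        simp only [partialOuter, if_true, Bool.false_eq_true, if_false]
        congr 1 <;> funext i <;> by_cases hi : i = a <;> grind
    · intro ω
      simp only [partialOuter]
      refine (hcompat _ (fun i => if i ∈ S then ω i else Function.update ν a true i) _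
        fun i => ?_).trans ?_
      · by_cases hi : i = a <;> grind
      · congr 1 <;> funext i <;> by_cases hi : i = a <;> grind

/-- In a cubespace with the glueing property, the outer cube
`ω ↦ t_ω(0,…,0)` of any tri-cube `(t_ν)` is a cube. -/
theorem tricube_outer_cube {X : Type*} (CS : Cubespace X) (hglue : HasGlueing CS) (k : ℕ)
    (t : (Fin k → Bool) → (Fin k → Bool) → X)
    (ht : ∀ ν, t ν ∈ CS.C k)
    (hcompat : ∀ ν ν' ω : Fin k → Bool,
      (∀ i, ν i = ν' i ∨ ω i = true) → t ν ω = t ν' ω) :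
    (fun ω => t ω (fun _ => false)) ∈ CS.C k := by
  convert partialOuter_mem CS hglue t ht hcompat Finset.univ (fun _ => false) using 1
  funext ω
  simp [partialOuter]
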